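/- Let g ≥ 3. There exist constants c = c(g) > 0 and K_0 = K_0(g) such that for all integers K ≥ K_0, all integers M with g^{K−1} < M ≤ g^K, and all integers k_1, k_2, k_3 with |k_i − μ_K| ≤ C_g for i = 1,2,3 and k_1 + k_2 + k_3 ≡ M (mod g−1), one has | ∫_𝔐 f_{k_1}(θ) f_{k_2}(θ) f_{k_3}(θ) e(−Mθ) dθ − (g−1)M²/(2(2πσ²K)^{3/2}) | ≤ c · M² (log K)⁴ K^{−7/4}. -/

import Mathlib

set_option autoImplicit false

open MeasureTheory

noncomputable section

/-- `e(x) = exp(2πix)`. -/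
def eC (x : ℝ) : ℂ := Complex.exp (2 * Real.pi * Complex.I * x)

/-- Base-`g` digit sum. -/
def digitSum (g n : ℕ) : ℕ := (Nat.digits g n).sum

/-- `S_g(k)`: naturals below `g^K` with base-`g` digit sum `k`. -/
def Sset (g K : ℕ) (k : ℤ) : Finset ℕ :=
  (Finset.range (g ^ K)).filter fun n => (digitSum g n : ℤ) = k

/-- The exponential sum `f_k(θ) = Σ_{n ∈ S_g(k)} e(nθ)`. -/
def fsum (g K : ℕ) (k : ℤ) (θ : ℝ) : ℂ := ∑ n ∈ Sset g K k, eC ((n : ℝ) * θ)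

/-- The average digit sum `μ_K = (g-1)K/2`. -/
def muK (g K : ℕ) : ℝ := ((g : ℝ) - 1) * K / 2

/-- `C_g = g(g-1) ∏_{p ≤ 10g², p prime} p`. -/
def Cg (g : ℕ) : ℕ := g * (g - 1) * ∏ p ∈ (Finset.Iic (10 * g ^ 2)).filter Nat.Prime, p

/-- The major-arc width `ε = K^{3/4} g^{-K} / (g-1)`. -/
def epsK (g K : ℕ) : ℝ := (K : ℝ) ^ ((3 : ℝ) / 4) * ((g : ℝ) ^ K)⁻¹ / ((g : ℝ) - 1)

/-- The major arcs `𝔐 = ⋃_{j=0}^{g-2} [j/(g-1) - ε, j/(g-1) + ε]`, viewed (via a set of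
representatives in `ℝ`) as a subset of `ℝ/ℤ`. -/
def majorArcs (g K : ℕ) : Set ℝ :=
  ⋃ j ∈ Finset.range (g - 1),
    Set.Icc ((j : ℝ) / ((g : ℝ) - 1) - epsK g K) ((j : ℝ) / ((g : ℝ) - 1) + epsK g K)


/-! ### Digit sums -/

lemma digitSum_zero (g : ℕ) : digitSum g 0 = 0 := by simp [digitSum]

lemma digitSum_add_mul {g : ℕ} (hg : 1 < g) {d : ℕ} (hd : d < g) (m : ℕ) :
    digitSum g (d + g * m) = d + digitSum g m := by
  by_cases h : d ≠ 0 ∨ m ≠ 0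
  · simp [digitSum, Nat.digits_add g hg d m hd h]
  · obtain ⟨rfl, rfl⟩ : d = 0 ∧ m = 0 := by simpa using h
    simp [digitSum_zero]

lemma digitSum_block {g : ℕ} (hg : 1 < g) (L a : ℕ) :
    ∀ {b : ℕ}, b < g ^ L → digitSum g (g ^ L * a + b) = digitSum g a + digitSum g b := by
  induction L with
  | zero => intro b hb; simp_all [digitSum_zero]
  | succ L ih =>
    intro b hb
    have hd : b % g < g := Nat.mod_lt _ (by omega)
    have hb' : b / g < g ^ L := by
      rw [Nat.div_lt_iff_lt_mul (by omega)]; rwa [pow_succ] at hb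
    have e1 : g ^ (L + 1) * a + b = b % g + g * (g ^ L * a + b / g) := by
      conv_lhs => rw [← Nat.mod_add_div b g]
      ring
    have e2 : digitSum g b = b % g + digitSum g (b / g) := by
      conv_lhs => rw [← Nat.mod_add_div b g]
      exact digitSum_add_mul hg hd _
    rw [e1, digitSum_add_mul hg hd, ih hb', e2]
    ring

lemma digitSum_of_lt {g d : ℕ} (hg : 1 < g) (hd : d < g) : digitSum g d = d := by
  simpa [digitSum_zero] using digitSum_add_mul hg hd 0

lemma digitSum_le {g : ℕ} (hg : 1 < g) (L : ℕ) :
    ∀ {a : ℕ}, a < g ^ L → digitSum g a ≤ (g - 1) * L := by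
  induction L with
  | zero => intro a ha; simp_all [digitSum_zero]
  | succ L ih =>
    intro a ha
    have hd : a % g < g := Nat.mod_lt _ (by omega)
    have ha' : a / g < g ^ L := by
      rw [Nat.div_lt_iff_lt_mul (by omega)]; rwa [pow_succ] at ha
    have e : digitSum g a = a % g + digitSum g (a / g) := by
      conv_lhs => rw [← Nat.mod_add_div a g]
      exact digitSum_add_mul hg hd _
    have := ih ha'
    rw [e, mul_add]
    omega

/-- Summation over `range (m * n)` in blocks of length `n`. -/
lemma sum_range_mul_blocks {A : Type*} [AddCommMonoid A] (f : ℕ → A) (n m : ℕ) :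
    ∑ x ∈ Finset.range (n * m), f x =
      ∑ a ∈ Finset.range m, ∑ b ∈ Finset.range n, f (n * a + b) := by
  induction m with
  | zero => simp
  | succ m ih => rw [mul_add, mul_one, Finset.sum_range_add, ih, Finset.sum_range_succ]

/-! ### The characteristic function of a uniform digit -/

/-- The characteristic function of a uniformly distributed centred base-`g` digit. -/
def digitChar (g : ℕ) (x : ℝ) : ℝ :=
  (∑ d ∈ Finset.range g, Real.cos (((d : ℝ) - ((g : ℝ) - 1) / 2) * x)) / g

lemma sum_exp_centred_digit {g : ℕ} (hg : 0 < g) (x : ℝ) :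
    ∑ d ∈ Finset.range g, Complex.exp ((((d : ℝ) - ((g : ℝ) - 1) / 2) * x : ℝ) * Complex.I) =
      ((g * digitChar g x : ℝ) : ℂ) := by
  have hg' : (g : ℝ) ≠ 0 := by positivity
  have hs : ∑ d ∈ Finset.range g, Real.sin (((d : ℝ) - ((g : ℝ) - 1) / 2) * x) = 0 := by
    have h := Finset.sum_range_reflect
      (fun d : ℕ => Real.sin (((d : ℝ) - ((g : ℝ) - 1) / 2) * x)) g
    have h2 : ∑ d ∈ Finset.range g, Real.sin ((((g - 1 - d : ℕ) : ℝ) - ((g : ℝ) - 1) / 2) * x) =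
        -∑ d ∈ Finset.range g, Real.sin (((d : ℝ) - ((g : ℝ) - 1) / 2) * x) := by
      rw [← Finset.sum_neg_distrib]
      refine Finset.sum_congr rfl fun d hd => ?_
      have hd' := Finset.mem_range.1 hd
      rw [← Real.sin_neg, Nat.cast_sub (by omega), Nat.cast_sub (by omega)]
      congr 1
      push_cast
      ring
    linarith
  have e : (g : ℝ) * digitChar g x =
      ∑ d ∈ Finset.range g, Real.cos (((d : ℝ) - ((g : ℝ) - 1) / 2) * x) := by
    rw [digitChar, mul_div_cancel₀ _ hg']
  apply Complex.ext
  · rw [Complex.ofReal_re, e, Complex.re_sum]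
    exact Finset.sum_congr rfl fun d _ => Complex.exp_ofReal_mul_I_re _
  · rw [Complex.ofReal_im, ← hs, Complex.im_sum]
    exact Finset.sum_congr rfl fun d _ => Complex.exp_ofReal_mul_I_im _

lemma sum_exp_centred_digitSum {g : ℕ} (hg : 1 < g) (L : ℕ) (x : ℝ) :
    ∑ n ∈ Finset.range (g ^ L),
        Complex.exp ((((digitSum g n : ℝ) - muK g L) * x : ℝ) * Complex.I) =
      (((g * digitChar g x) ^ L : ℝ) : ℂ) := by
  induction L with
  | zero => simp [digitSum_zero, muK]
  | succ L ih =>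
    rw [pow_succ, sum_range_mul_blocks, pow_succ, Complex.ofReal_mul, ← ih, mul_comm,
      ← sum_exp_centred_digit (by omega), Finset.sum_mul_sum]
    refine Finset.sum_congr rfl fun a ha => Finset.sum_congr rfl fun b hb => ?_
    rw [digitSum_block hg L a (Finset.mem_range.1 hb),
      digitSum_of_lt hg (Finset.mem_range.1 ha), ← Complex.exp_add]
    congr 1
    simp only [muK]
    push_cast
    ring

lemma sum_cos_digitSum {g : ℕ} (hg : 1 < g) (L : ℕ) (j : ℤ) (x : ℝ) :
    ∑ n ∈ Finset.range (g ^ L), Real.cos (((digitSum g n - j : ℤ) : ℝ) * x) =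
      (g : ℝ) ^ L * (digitChar g x ^ L * Real.cos (((j : ℝ) - muK g L) * x)) := by
  have h := congrArg (fun z : ℂ => (z * Complex.exp (((muK g L - j) * x : ℝ) * Complex.I)).re)
    (sum_exp_centred_digitSum hg L x)
  simp only [Finset.sum_mul, Complex.re_sum, Complex.re_ofReal_mul,
    Complex.exp_ofReal_mul_I_re] at h
  rw [← mul_assoc, ← mul_pow, ← Real.cos_neg (((j : ℝ) - muK g L) * x)]
  rw [show -(((j : ℝ) - muK g L) * x) = (muK g L - j) * x by ring, ← h]
  refine Finset.sum_congr rfl fun n _ => ?_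
  rw [← Complex.exp_add, ← add_mul, ← Complex.ofReal_add, Complex.exp_ofReal_mul_I_re]
  congr 1
  push_cast
  ring

lemma integral_cos_int_mul (m : ℤ) :
    ∫ x in (-Real.pi)..Real.pi, Real.cos ((m : ℝ) * x) = if m = 0 then 2 * Real.pi else 0 := by
  split_ifs with h
  · subst h; simp; ring
  · have hm : (m : ℝ) ≠ 0 := by exact_mod_cast h
    rw [intervalIntegral.integral_comp_mul_left _ hm, integral_cos]
    simp [Real.sin_int_mul_pi]

lemma continuous_digitChar (g : ℕ) : Continuous (digitChar g) := by
  unfold digitChar; fun_prop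

lemma integral_digitChar_pow {g : ℕ} (hg : 1 < g) (L : ℕ) (j : ℤ) :
    ∫ x in (-Real.pi)..Real.pi, digitChar g x ^ L * Real.cos (((j : ℝ) - muK g L) * x) =
      2 * Real.pi * ((Sset g L j).card / (g : ℝ) ^ L) := by
  have hgL : (g : ℝ) ^ L ≠ 0 := by positivity
  have h : ∫ x in (-Real.pi)..Real.pi,
      ∑ n ∈ Finset.range (g ^ L), Real.cos (((digitSum g n - j : ℤ) : ℝ) * x) =
      2 * Real.pi * (Sset g L j).card := by
    rw [intervalIntegral.integral_finsetSum]
    · simp only [integral_cos_int_mul, sub_eq_zero]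
      rw [← Finset.sum_filter, Finset.sum_const, nsmul_eq_mul, mul_comm]
      rfl
    · intro n _
      exact Continuous.intervalIntegrable (by fun_prop) _ _
  simp only [sum_cos_digitSum hg, intervalIntegral.integral_const_mul] at h
  field_simp
  linarith

lemma abs_digitChar_le {g : ℕ} (hg : 2 ≤ g) {x : ℝ} (hx : |x| ≤ Real.pi) :
    |digitChar g x| ≤ Real.exp (-(1 / (g * Real.pi ^ 2)) * x ^ 2) := by
  have hg0 : (0 : ℝ) < g := by positivity
  have hpi := Real.pi_pos
  -- the first two digits already produce the cancellation
  have hcos : |Real.cos (x / 2)| ≤ 1 - x ^ 2 / (2 * Real.pi ^ 2) := by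
    have h0 : 0 ≤ Real.cos (x / 2) := by
      have := abs_le.1 hx
      exact Real.cos_nonneg_of_mem_Icc ⟨by linarith, by linarith⟩
    rw [abs_of_nonneg h0]
    have := Real.cos_le_one_sub_mul_cos_sq (x := x / 2)
      (by rw [abs_div, abs_of_pos (two_pos : (0 : ℝ) < 2)]; linarith [abs_nonneg x])
    calc _ ≤ _ := this
      _ = _ := by field_simp
  have hsum : |∑ d ∈ Finset.range g, Real.cos (((d : ℝ) - ((g : ℝ) - 1) / 2) * x)| ≤
      g - x ^ 2 / Real.pi ^ 2 := by
    obtain ⟨m, rfl⟩ := Nat.exists_eq_add_of_le hg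
    rw [Finset.sum_range_add]
    have h1 : |∑ d ∈ Finset.range 2, Real.cos (((d : ℝ) - (((2 + m : ℕ) : ℝ) - 1) / 2) * x)| ≤
        2 - x ^ 2 / Real.pi ^ 2 := by
      simp only [Finset.sum_range_succ, Finset.sum_range_zero, zero_add]
      rw [Real.cos_add_cos, abs_mul, abs_mul, abs_two]
      have e : ∀ y : ℝ, ((((0 : ℕ) : ℝ) - y) * x - (((1 : ℕ) : ℝ) - y) * x) / 2 = -(x / 2) := by
        intro y; push_cast; ring
      rw [e, Real.cos_neg]
      calc _ ≤ 2 * 1 * (1 - x ^ 2 / (2 * Real.pi ^ 2)) := by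
            gcongr
            exact Real.abs_cos_le_one _
        _ = _ := by field_simp
    have h2 : |∑ d ∈ Finset.range m,
        Real.cos ((((2 + d : ℕ) : ℝ) - (((2 + m : ℕ) : ℝ) - 1) / 2) * x)| ≤ m := by
      refine (Finset.abs_sum_le_sum_abs _ _).trans ?_
      refine (Finset.sum_le_sum fun d _ => Real.abs_cos_le_one _).trans ?_
      simp
    refine (abs_add_le _ _).trans ?_
    push_cast at h1 h2 ⊢
    linarith
  rw [digitChar, abs_div, abs_of_pos hg0]
  calc _ ≤ (g - x ^ 2 / Real.pi ^ 2) / g := by gcongr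
    _ = -(1 / (g * Real.pi ^ 2)) * x ^ 2 + 1 := by field_simp; ring
    _ ≤ _ := Real.add_one_le_exp _

lemma abs_cos_sub_le (y : ℝ) : |Real.cos y - (1 - y ^ 2 / 2)| ≤ y ^ 4 := by
  rcases le_total |y| 1 with h | h
  · refine (Real.cos_bound h).trans ?_
    have : |y| ^ 4 = y ^ 4 := Even.pow_abs (by decide) y
    rw [this]
    have : 0 ≤ y ^ 4 := by positivity
    linarith
  · have h1 := Real.one_sub_sq_div_two_le_cos (x := y)
    have h2 := Real.cos_le_one y
    have h3 : 1 ≤ y ^ 2 := by rw [← sq_abs]; nlinarith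
    rw [abs_of_nonneg (by linarith)]
    nlinarith

lemma abs_exp_neg_sub_le {u : ℝ} (hu : 0 ≤ u) : |Real.exp (-u) - (1 - u)| ≤ u ^ 2 := by
  rcases le_total u 1 with h | h
  · have := Real.abs_exp_sub_one_sub_id_le (x := -u) (by rwa [abs_neg, abs_of_nonneg hu])
    rw [neg_sq] at this
    convert this using 2
    ring
  · have h1 := Real.add_one_le_exp (-u)
    have h2 : Real.exp (-u) ≤ 1 := Real.exp_le_one_iff.2 (by linarith)
    rw [abs_of_nonneg (by linarith)]
    nlinarith

lemma sum_sq_centred_digit (g : ℕ) :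
    ∑ d ∈ Finset.range g, ((d : ℝ) - ((g : ℝ) - 1) / 2) ^ 2 = g * (((g : ℝ) ^ 2 - 1) / 12) := by
  have h : ∀ (n : ℕ) (y : ℝ), ∑ d ∈ Finset.range n, ((d : ℝ) - y) ^ 2 =
      n * (n - 1) * (2 * n - 1) / 6 - y * n * (n - 1) + n * y ^ 2 := by
    intro n y
    induction n with
    | zero => simp
    | succ n ih => rw [Finset.sum_range_succ, ih]; push_cast; ring
  rw [h]
  ring

/-- The digit variance. -/
def digitVar (g : ℕ) : ℝ := ((g : ℝ) ^ 2 - 1) / 12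

lemma abs_digitChar_sub_exp_le {g : ℕ} (hg : 1 ≤ g) (x : ℝ) :
    |digitChar g x - Real.exp (-(digitVar g / 2) * x ^ 2)| ≤ 2 * (g : ℝ) ^ 4 * x ^ 4 := by
  have hg0 : (0 : ℝ) < g := by positivity
  have hg1 : (1 : ℝ) ≤ g := by exact_mod_cast hg
  have hv : 0 ≤ digitVar g := by rw [digitVar]; nlinarith
  have hv' : digitVar g / 2 ≤ (g : ℝ) ^ 2 := by rw [digitVar]; nlinarith
  have h1 : |digitChar g x - (1 - digitVar g / 2 * x ^ 2)| ≤ (g : ℝ) ^ 4 * x ^ 4 := by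
    have e : digitChar g x - (1 - digitVar g / 2 * x ^ 2) =
        (∑ d ∈ Finset.range g, (Real.cos (((d : ℝ) - ((g : ℝ) - 1) / 2) * x) -
          (1 - (((d : ℝ) - ((g : ℝ) - 1) / 2) * x) ^ 2 / 2))) / g := by
      rw [Finset.sum_sub_distrib, Finset.sum_sub_distrib]
      simp only [mul_pow]
      rw [← Finset.sum_div, ← Finset.sum_mul, sum_sq_centred_digit, digitChar, digitVar]
      simp only [Finset.sum_const, Finset.card_range, nsmul_eq_mul, mul_one]
      generalize ∑ d ∈ Finset.range g, Real.cos (((d : ℝ) - ((g : ℝ) - 1) / 2) * x) = S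
      field_simp
    rw [e, abs_div, abs_of_pos hg0, div_le_iff₀ hg0]
    refine (Finset.abs_sum_le_sum_abs _ _).trans ?_
    refine (Finset.sum_le_sum (g := fun _ => (g : ℝ) ^ 4 * x ^ 4) fun d hd => ?_).trans ?_
    · refine (abs_cos_sub_le _).trans ?_
      rw [mul_pow]
      gcongr ?_ * _
      have hd' : (d : ℝ) + 1 ≤ g := by exact_mod_cast Finset.mem_range.1 hd
      have hd0 : (0 : ℝ) ≤ d := by positivity
      rw [← Even.pow_abs (by decide : Even 4)]
      gcongr
      rw [abs_le]
      constructor <;> linarith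
    · simp [mul_comm]
  have h2 := abs_exp_neg_sub_le (u := digitVar g / 2 * x ^ 2) (by positivity)
  have h3 : (digitVar g / 2 * x ^ 2) ^ 2 ≤ (g : ℝ) ^ 4 * x ^ 4 := by
    calc _ ≤ ((g : ℝ) ^ 2 * x ^ 2) ^ 2 := by gcongr
      _ = _ := by ring
  rw [neg_mul]
  rw [abs_sub_comm] at h2
  calc _ ≤ _ := abs_sub_le _ (1 - digitVar g / 2 * x ^ 2) _
    _ ≤ _ := by linarith

/-! ### A local limit theorem -/

lemma sq_le_exp {b : ℝ} (hb : 0 < b) (x : ℝ) : x ^ 2 ≤ 2 / b * Real.exp (b / 2 * x ^ 2) := by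
  have := Real.add_one_le_exp (b / 2 * x ^ 2)
  calc x ^ 2 = 2 / b * (b / 2 * x ^ 2) := by field_simp
    _ ≤ _ := by gcongr; linarith

lemma pow_four_le_exp {b : ℝ} (hb : 0 < b) (x : ℝ) :
    x ^ 4 ≤ 16 / b ^ 2 * Real.exp (b / 2 * x ^ 2) := by
  have h := sq_le_exp (half_pos hb) x
  calc x ^ 4 = (x ^ 2) ^ 2 := by ring
    _ ≤ (2 / (b / 2) * Real.exp (b / 2 / 2 * x ^ 2)) ^ 2 := by gcongr
    _ = _ := by
      rw [mul_pow, ← Real.exp_nat_mul]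
      congr 1
      · field_simp; norm_num
      · congr 1; push_cast; ring

/-- Pointwise comparison of a power of a characteristic function with its Gaussian model. -/
lemma abs_charPow_sub_gaussian_le {φ : ℝ → ℝ} {c s A : ℝ} (hc : 0 < c) (hcs : c ≤ s)
    (hA : 0 ≤ A) (h1 : ∀ x, |x| ≤ Real.pi → |φ x| ≤ Real.exp (-c * x ^ 2))
    (h2 : ∀ x, |φ x - Real.exp (-s * x ^ 2)| ≤ A * x ^ 4) {L : ℕ} (hL : 2 ≤ L) (δ x : ℝ) :
    |(Set.Icc (-Real.pi) Real.pi).indicator (fun x => φ x ^ L * Real.cos (δ * x)) x -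
        Real.exp (-(s * L) * x ^ 2)| ≤
      (4 / c + 64 * A / c ^ 2) * (1 + δ ^ 2) / L * Real.exp (-(c * L / 4) * x ^ 2) := by
  have hL0 : (0 : ℝ) < L := by positivity
  have hL2 : (2 : ℝ) ≤ L := by exact_mod_cast hL
  set b : ℝ := c * L / 2 with hb
  have hb0 : 0 < b := by positivity
  have hx2 : x ^ 2 * Real.exp (-b * x ^ 2) ≤ 4 / (c * L) * Real.exp (-(c * L / 4) * x ^ 2) := by
    calc _ ≤ 2 / b * Real.exp (b / 2 * x ^ 2) * Real.exp (-b * x ^ 2) := by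
          gcongr; exact sq_le_exp hb0 x
      _ = _ := by
        rw [mul_assoc, ← Real.exp_add]
        congr 1
        · rw [hb]; field_simp; norm_num
        · congr 1; rw [hb]; ring
  have hx4 : L * x ^ 4 * Real.exp (-b * x ^ 2) ≤
      64 / (c ^ 2 * L) * Real.exp (-(c * L / 4) * x ^ 2) := by
    calc _ ≤ L * (16 / b ^ 2 * Real.exp (b / 2 * x ^ 2)) * Real.exp (-b * x ^ 2) := by
          gcongr; exact pow_four_le_exp hb0 x
      _ = L * (16 / b ^ 2) * (Real.exp (b / 2 * x ^ 2) * Real.exp (-b * x ^ 2)) := by ring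
      _ = _ := by
        rw [← Real.exp_add]
        congr 1
        · rw [hb]; field_simp; norm_num
        · congr 1; rw [hb]; ring
  have key : (4 / c + 64 * A / c ^ 2) * (1 + δ ^ 2) / L * Real.exp (-(c * L / 4) * x ^ 2) =
      (1 + δ ^ 2) * (4 / (c * L) * Real.exp (-(c * L / 4) * x ^ 2)) +
      (1 + δ ^ 2) * A * (64 / (c ^ 2 * L) * Real.exp (-(c * L / 4) * x ^ 2)) := by
    field_simp
  rw [key]
  have hδ : 0 ≤ δ ^ 2 := sq_nonneg δ
  have hT : 0 ≤ A * (64 / (c ^ 2 * L) * Real.exp (-(c * L / 4) * x ^ 2)) := by positivity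
  have hT2 : 0 ≤ 4 / (c * L) * Real.exp (-(c * L / 4) * x ^ 2) := by positivity
  have hcL : Real.exp (-(c * L) * x ^ 2) ≤ Real.exp (-b * x ^ 2) := by
    rw [Real.exp_le_exp, hb]; nlinarith [mul_nonneg (mul_nonneg hc.le hL0.le) (sq_nonneg x)]
  by_cases hx : |x| ≤ Real.pi
  · rw [Set.indicator_of_mem (by rwa [Set.mem_Icc, ← abs_le])]
    have hs : Real.exp (-(s * L) * x ^ 2) = Real.exp (-s * x ^ 2) ^ L := by
      rw [← Real.exp_nat_mul]; congr 1; ring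
    have hψ : Real.exp (-s * x ^ 2) ≤ Real.exp (-c * x ^ 2) := by
      rw [Real.exp_le_exp]; nlinarith [sq_nonneg x]
    have t1 : |φ x ^ L * Real.cos (δ * x) - φ x ^ L| ≤ δ ^ 2 * (x ^ 2 * Real.exp (-b * x ^ 2)) := by
      have hc1 : |Real.cos (δ * x) - 1| ≤ δ ^ 2 * x ^ 2 := by
        have := Real.one_sub_sq_div_two_le_cos (x := δ * x)
        have := Real.cos_le_one (δ * x)
        rw [abs_le]
        constructor <;> nlinarith [sq_nonneg (δ * x)]
      rw [show φ x ^ L * Real.cos (δ * x) - φ x ^ L = φ x ^ L * (Real.cos (δ * x) - 1) by ring,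
        abs_mul, abs_pow]
      calc _ ≤ Real.exp (-c * x ^ 2) ^ L * (δ ^ 2 * x ^ 2) := by
            gcongr; exact h1 x hx
        _ = Real.exp (-(c * L) * x ^ 2) * (δ ^ 2 * x ^ 2) := by
            rw [← Real.exp_nat_mul]; congr 2; ring
        _ ≤ Real.exp (-b * x ^ 2) * (δ ^ 2 * x ^ 2) := by gcongr
        _ = _ := by ring
    have t2 : |φ x ^ L - Real.exp (-(s * L) * x ^ 2)| ≤
        A * (L * x ^ 4 * Real.exp (-b * x ^ 2)) := by
      rw [hs]
      refine (abs_pow_sub_pow_le _ _ _).trans ?_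
      have hm : max |φ x| |Real.exp (-s * x ^ 2)| ≤ Real.exp (-c * x ^ 2) := by
        rw [abs_of_pos (Real.exp_pos _)]
        exact max_le (h1 x hx) hψ
      calc _ ≤ A * x ^ 4 * L * Real.exp (-c * x ^ 2) ^ (L - 1) := by
            gcongr; exact h2 x
        _ ≤ A * x ^ 4 * L * Real.exp (-b * x ^ 2) := by
            gcongr
            rw [← Real.exp_nat_mul, Real.exp_le_exp, Nat.cast_sub (by omega), hb]
            push_cast
            nlinarith [mul_nonneg (mul_nonneg hc.le (sub_nonneg.2 hL2)) (sq_nonneg x)]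
        _ = _ := by ring
    calc _ ≤ _ := abs_sub_le _ (φ x ^ L) _
      _ ≤ δ ^ 2 * (x ^ 2 * Real.exp (-b * x ^ 2)) + A * (L * x ^ 4 * Real.exp (-b * x ^ 2)) :=
        add_le_add t1 t2
      _ ≤ δ ^ 2 * (4 / (c * L) * Real.exp (-(c * L / 4) * x ^ 2)) +
          A * (64 / (c ^ 2 * L) * Real.exp (-(c * L / 4) * x ^ 2)) := by gcongr
      _ ≤ _ := by nlinarith
  · rw [Set.indicator_of_notMem (by rwa [Set.mem_Icc, ← abs_le]), zero_sub, abs_neg,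
      abs_of_pos (Real.exp_pos _)]
    have hx1 : 1 ≤ x ^ 2 := by
      rw [← sq_abs]; nlinarith [Real.pi_gt_three]
    calc Real.exp (-(s * L) * x ^ 2) ≤ Real.exp (-(c * L) * x ^ 2) := by
          rw [Real.exp_le_exp]
          nlinarith [mul_nonneg (mul_nonneg (sub_nonneg.2 hcs) hL0.le) (sq_nonneg x)]
      _ ≤ Real.exp (-b * x ^ 2) := hcL
      _ ≤ x ^ 2 * Real.exp (-b * x ^ 2) := le_mul_of_one_le_left (Real.exp_pos _).le hx1
      _ ≤ 4 / (c * L) * Real.exp (-(c * L / 4) * x ^ 2) := hx2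
      _ ≤ _ := by nlinarith

lemma exists_abs_integral_charPow_sub_le {φ : ℝ → ℝ} (hφ : Continuous φ) {c s A : ℝ} (hc : 0 < c)
    (hcs : c ≤ s) (hA : 0 ≤ A) (h1 : ∀ x, |x| ≤ Real.pi → |φ x| ≤ Real.exp (-c * x ^ 2))
    (h2 : ∀ x, |φ x - Real.exp (-s * x ^ 2)| ≤ A * x ^ 4) :
    ∃ C : ℝ, 0 < C ∧ ∀ L : ℕ, 2 ≤ L → ∀ δ : ℝ,
      |(∫ x in (-Real.pi)..Real.pi, φ x ^ L * Real.cos (δ * x)) - √(Real.pi / (s * L))| ≤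
        C * (1 + δ ^ 2) / (L * √L) := by
  have hs : 0 < s := hc.trans_le hcs
  have hpi := Real.pi_pos
  refine ⟨(4 / c + 64 * A / c ^ 2) * √(Real.pi / (c / 4)), by positivity, fun L hL δ => ?_⟩
  have hL0 : (0 : ℝ) < L := by positivity
  have hi : IntervalIntegrable (fun x => φ x ^ L * Real.cos (δ * x)) volume (-Real.pi) Real.pi :=
    Continuous.intervalIntegrable (by fun_prop) _ _
  have hint : Integrable
      ((Set.Icc (-Real.pi) Real.pi).indicator (fun x => φ x ^ L * Real.cos (δ * x))) := by
    rw [integrable_indicator_iff measurableSet_Icc]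
    exact (intervalIntegrable_iff_integrableOn_Icc_of_le (by linarith)).1 hi
  have hg := integrable_exp_neg_mul_sq (b := s * L) (by positivity)
  have e : (∫ x in (-Real.pi)..Real.pi, φ x ^ L * Real.cos (δ * x)) - √(Real.pi / (s * L)) =
      ∫ x, ((Set.Icc (-Real.pi) Real.pi).indicator (fun x => φ x ^ L * Real.cos (δ * x)) x -
        Real.exp (-(s * L) * x ^ 2)) := by
    rw [integral_sub hint hg, integral_gaussian, integral_indicator measurableSet_Icc,
      integral_Icc_eq_integral_Ioc, intervalIntegral.integral_of_le (by linarith)]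
  rw [e, ← Real.norm_eq_abs]
  refine (norm_integral_le_of_norm_le
    ((integrable_exp_neg_mul_sq (b := c * L / 4) (by positivity)).const_mul _)
    (Filter.Eventually.of_forall fun x => by
      rw [Real.norm_eq_abs]
      exact abs_charPow_sub_gaussian_le hc hcs hA h1 h2 hL δ x)).trans ?_
  rw [integral_const_mul, integral_gaussian,
    show Real.pi / (c * L / 4) = Real.pi / (c / 4) / L by field_simp, Real.sqrt_div (by positivity)]
  apply le_of_eq
  field_simp

/-- The number of `L`-digit strings with digit sum `j`, near the centre. -/
lemma exists_abs_card_Sset_sub_le {g : ℕ} (hg : 2 ≤ g) :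
    ∃ C : ℝ, 0 < C ∧ ∀ L : ℕ, 2 ≤ L → ∀ j : ℤ,
      |((Sset g L j).card : ℝ) / (g : ℝ) ^ L - 1 / √(2 * Real.pi * digitVar g * L)| ≤
        C * (1 + ((j : ℝ) - muK g L) ^ 2) / (L * √L) := by
  have hg2 : (2 : ℝ) ≤ g := by exact_mod_cast hg
  have hpi := Real.pi_pos
  have hpi3 := Real.pi_gt_three
  have hv : 0 < digitVar g := by rw [digitVar]; nlinarith
  have hcs : 1 / (g * Real.pi ^ 2) ≤ digitVar g / 2 := by
    rw [div_le_iff₀ (by positivity), digitVar]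
    have h9 : 9 ≤ Real.pi ^ 2 := by nlinarith
    have : 2 * 9 ≤ (g : ℝ) * Real.pi ^ 2 := by gcongr
    have : 3 ≤ (g : ℝ) ^ 2 - 1 := by nlinarith
    nlinarith
  obtain ⟨C, hC, h⟩ := exists_abs_integral_charPow_sub_le (continuous_digitChar g)
    (c := 1 / (g * Real.pi ^ 2)) (s := digitVar g / 2) (A := 2 * (g : ℝ) ^ 4) (by positivity)
    hcs (by positivity) (fun x hx => abs_digitChar_le hg hx)
    (fun x => abs_digitChar_sub_exp_le (by omega) x)
  refine ⟨C, hC, fun L hL j => ?_⟩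
  have hL0 : (0 : ℝ) < L := by positivity
  have h' := h L hL ((j : ℝ) - muK g L)
  rw [integral_digitChar_pow (by omega)] at h'
  have e : √(Real.pi / (digitVar g / 2 * L)) =
      2 * Real.pi * (1 / √(2 * Real.pi * digitVar g * L)) := by
    rw [Real.sqrt_eq_iff_mul_self_eq (by positivity) (by positivity)]
    rw [show 2 * Real.pi * (1 / √(2 * Real.pi * digitVar g * L)) *
      (2 * Real.pi * (1 / √(2 * Real.pi * digitVar g * L))) = 4 * Real.pi ^ 2 /
        (√(2 * Real.pi * digitVar g * L) * √(2 * Real.pi * digitVar g * L)) by field_simp; norm_num,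
      Real.mul_self_sqrt (by positivity)]
    field_simp
    norm_num
  rw [e, ← mul_sub, abs_mul, abs_of_pos (by positivity)] at h'
  refine le_trans ?_ h'
  exact le_mul_of_one_le_left (abs_nonneg _) (by linarith)

/-! ### Exponential sums near the origin -/

lemma eC_add (x y : ℝ) : eC (x + y) = eC x * eC y := by
  rw [eC, eC, eC, ← Complex.exp_add]; congr 1; push_cast; ring

lemma eC_eq (x : ℝ) : eC x = Complex.exp (((2 * Real.pi * x : ℝ) : ℂ) * Complex.I) := by
  rw [eC]; congr 1; push_cast; ring

lemma norm_eC (x : ℝ) : ‖eC x‖ = 1 := by rw [eC_eq, Complex.norm_exp_ofReal_mul_I]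

lemma eC_int (m : ℤ) : eC m = 1 := by
  rw [eC, Complex.exp_eq_one_iff]; exact ⟨m, by push_cast; ring⟩

@[fun_prop]
lemma continuous_eC : Continuous eC := by unfold eC; fun_prop

lemma norm_eC_sub_eC_le (x y : ℝ) : ‖eC (x + y) - eC x‖ ≤ 2 * Real.pi * |y| := by
  have : eC (x + y) - eC x = eC x * (eC y - 1) := by rw [eC_add]; ring
  rw [this, norm_mul, norm_eC, one_mul, eC_eq, mul_comm]
  refine Real.norm_exp_I_mul_ofReal_sub_one_le.trans (le_of_eq ?_)
  rw [Real.norm_eq_abs, abs_mul, abs_of_pos Real.two_pi_pos]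

lemma norm_fsum_sub_le_of_blocks {g : ℕ} (hg : 1 < g) {L t : ℕ} {k : ℤ} {ρ Q : ℝ}
    (hρ0 : 0 ≤ ρ) (hρ1 : ρ ≤ 1)
    (hQ : ∀ a < g ^ t, |((Sset g L (k - digitSum g a)).card : ℝ) / (g : ℝ) ^ L - ρ| ≤ Q) (β : ℝ) :
    ‖fsum g (L + t) k β - ρ * ∑ n ∈ Finset.range (g ^ (L + t)), eC ((n : ℝ) * β)‖ ≤
      (g : ℝ) ^ (L + t) * (2 * Real.pi * ((g : ℝ) ^ L * |β|) + Q) := by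
  have hgL : (0 : ℝ) < (g : ℝ) ^ L := by positivity
  have hpi := Real.pi_pos
  have e : fsum g (L + t) k β - ρ * ∑ n ∈ Finset.range (g ^ (L + t)), eC ((n : ℝ) * β) =
      ∑ a ∈ Finset.range (g ^ t), ∑ b ∈ Finset.range (g ^ L),
        (((if (digitSum g b : ℤ) = k - digitSum g a then (1 : ℝ) else 0) - ρ : ℝ) : ℂ) *
          eC (((g : ℝ) ^ L * a + b) * β) := by
    rw [fsum, Sset, Finset.sum_filter, pow_add, sum_range_mul_blocks, sum_range_mul_blocks,
      Finset.mul_sum, ← Finset.sum_sub_distrib]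
    refine Finset.sum_congr rfl fun a _ => ?_
    rw [Finset.mul_sum, ← Finset.sum_sub_distrib]
    refine Finset.sum_congr rfl fun b hb => ?_
    rw [digitSum_block hg L a (Finset.mem_range.1 hb)]
    have : ((digitSum g a + digitSum g b : ℕ) : ℤ) = k ↔
        (digitSum g b : ℤ) = k - digitSum g a := by push_cast; constructor <;> intro h <;> linarith
    simp only [this]
    push_cast
    split_ifs <;> push_cast <;> ring
  have hblock : ∀ a ∈ Finset.range (g ^ t), ‖∑ b ∈ Finset.range (g ^ L),
        (((if (digitSum g b : ℤ) = k - digitSum g a then (1 : ℝ) else 0) - ρ : ℝ) : ℂ) *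
          eC (((g : ℝ) ^ L * a + b) * β)‖ ≤ (g : ℝ) ^ L * (2 * Real.pi * ((g : ℝ) ^ L * |β|) + Q) := by
    intro a ha
    have e2 : ∑ b ∈ Finset.range (g ^ L),
        (((if (digitSum g b : ℤ) = k - digitSum g a then (1 : ℝ) else 0) - ρ : ℝ) : ℂ) *
          eC (((g : ℝ) ^ L * a + b) * β) =
        ∑ b ∈ Finset.range (g ^ L),
          (((if (digitSum g b : ℤ) = k - digitSum g a then (1 : ℝ) else 0) - ρ : ℝ) : ℂ) *
            (eC ((g : ℝ) ^ L * a * β + b * β) - eC ((g : ℝ) ^ L * a * β)) +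
        (((Sset g L (k - digitSum g a)).card - ρ * (g : ℝ) ^ L : ℝ) : ℂ) *
          eC ((g : ℝ) ^ L * a * β) := by
      have hc : (((Sset g L (k - digitSum g a)).card - ρ * (g : ℝ) ^ L : ℝ) : ℂ) =
          ∑ b ∈ Finset.range (g ^ L),
          (((if (digitSum g b : ℤ) = k - digitSum g a then (1 : ℝ) else 0) - ρ : ℝ) : ℂ) := by
        rw [← Complex.ofReal_sum, Finset.sum_sub_distrib, ← Finset.sum_filter, Finset.sum_const,
          Finset.sum_const, Finset.card_range]
        simp only [Sset, nsmul_eq_mul, mul_one]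
        push_cast
        ring
      rw [hc, Finset.sum_mul, ← Finset.sum_add_distrib]
      refine Finset.sum_congr rfl fun b _ => ?_
      rw [add_mul]
      ring
    rw [e2, mul_add]
    refine (norm_add_le _ _).trans (add_le_add ?_ ?_)
    · refine (norm_sum_le_of_le _ (f := _) (n := fun _ => 2 * Real.pi * ((g : ℝ) ^ L * |β|))
        fun b hb => ?_).trans (le_of_eq (by simp))
      rw [norm_mul, Complex.norm_real, Real.norm_eq_abs]
      have h1 : |(if (digitSum g b : ℤ) = k - digitSum g a then (1 : ℝ) else 0) - ρ| ≤ 1 := by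
        rw [abs_le]; split_ifs <;> constructor <;> linarith
      have h2 := norm_eC_sub_eC_le ((g : ℝ) ^ L * a * β) (b * β)
      have hb' : (b : ℝ) ≤ (g : ℝ) ^ L := by exact_mod_cast (Finset.mem_range.1 hb).le
      calc _ ≤ 1 * (2 * Real.pi * |b * β|) := by gcongr
        _ = 2 * Real.pi * (b * |β|) := by rw [abs_mul, Nat.abs_cast]; ring
        _ ≤ _ := by gcongr
    · rw [norm_mul, norm_eC, mul_one, Complex.norm_real, Real.norm_eq_abs]
      have h := hQ a (Finset.mem_range.1 ha)
      calc _ = |(g : ℝ) ^ L * (((Sset g L (k - digitSum g a)).card : ℝ) / (g : ℝ) ^ L - ρ)| := by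
            congr 1; field_simp
        _ = (g : ℝ) ^ L * |((Sset g L (k - digitSum g a)).card : ℝ) / (g : ℝ) ^ L - ρ| := by
            rw [abs_mul, abs_of_pos hgL]
        _ ≤ _ := by gcongr
  rw [e]
  refine (norm_sum_le_of_le _ hblock).trans (le_of_eq ?_)
  simp only [Finset.sum_const, Finset.card_range, nsmul_eq_mul, Nat.cast_pow]
  rw [pow_add]
  ring

/-- The density of integers with a fixed central digit sum. -/
def digitDensity (g K : ℕ) : ℝ := 1 / √(2 * Real.pi * digitVar g * K)

lemma one_le_two_pi_mul_digitVar {g : ℕ} (hg : 3 ≤ g) : 1 ≤ 2 * Real.pi * digitVar g := by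
  have hg' : (3 : ℝ) ≤ g := by exact_mod_cast hg
  have := Real.pi_gt_three
  have h : 2 / 3 ≤ digitVar g := by rw [digitVar]; nlinarith
  nlinarith

lemma digitDensity_nonneg (g K : ℕ) : 0 ≤ digitDensity g K := by unfold digitDensity; positivity

lemma digitDensity_le {g : ℕ} (hg : 3 ≤ g) {K : ℕ} (hK : 0 < K) :
    digitDensity g K ≤ 1 / √(K : ℝ) := by
  have := one_le_two_pi_mul_digitVar hg
  have hK' : (0 : ℝ) < K := by exact_mod_cast hK
  unfold digitDensity
  gcongr
  nlinarith

lemma abs_digitDensity_sub_le {g : ℕ} (hg : 3 ≤ g) {L K : ℕ} (hL : 0 < L) (hLK : L ≤ K)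
    (hK : K ≤ 2 * L) :
    |digitDensity g L - digitDensity g K| ≤ 2 * (K - L) / (K * √K) := by
  have hv := one_le_two_pi_mul_digitVar hg
  have hL0 : (0 : ℝ) < L := by exact_mod_cast hL
  have hLK' : (L : ℝ) ≤ K := by exact_mod_cast hLK
  have hK2 : (K : ℝ) ≤ 2 * L := by exact_mod_cast hK
  have hK0 : (0 : ℝ) < K := by linarith
  have e : digitDensity g L - digitDensity g K =
      1 / √(2 * Real.pi * digitVar g) * (1 / √(L : ℝ) - 1 / √(K : ℝ)) := by
    have hv0 : 0 ≤ 2 * Real.pi * digitVar g := zero_le_one.trans hv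
    rw [digitDensity, digitDensity, Real.sqrt_mul hv0, Real.sqrt_mul hv0, mul_sub,
      div_mul_div_comm, div_mul_div_comm, one_mul]
  have h1 : 1 / √(2 * Real.pi * digitVar g) ≤ 1 := by
    rw [div_le_one (by positivity)]
    exact Real.one_le_sqrt.2 hv
  have hsL : 0 < √(L : ℝ) := Real.sqrt_pos.2 hL0
  have hsK : 0 < √(K : ℝ) := Real.sqrt_pos.2 hK0
  have hss : √(L : ℝ) ≤ √(K : ℝ) := Real.sqrt_le_sqrt hLK'
  have qL := Real.sq_sqrt hL0.le
  have qK := Real.sq_sqrt hK0.le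
  have hs2 : √(K : ℝ) ≤ 2 * √(L : ℝ) := by
    rw [Real.sqrt_le_left (by positivity), mul_pow, qL]; linarith
  have h0 : 0 ≤ 1 / √(L : ℝ) - 1 / √(K : ℝ) := by
    rw [sub_nonneg]; gcongr
  rw [e, abs_of_nonneg (by positivity)]
  calc _ ≤ 1 * (1 / √(L : ℝ) - 1 / √(K : ℝ)) := by gcongr
    _ = (K - L) / (√(L : ℝ) * √(K : ℝ) * (√(K : ℝ) + √(L : ℝ))) := by
      rw [one_mul, div_sub_div _ _ hsL.ne' hsK.ne', div_eq_div_iff (by positivity) (by positivity),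
        ← qL, ← qK, Real.sqrt_sq hsL.le, Real.sqrt_sq hsK.le]
      ring
    _ ≤ (K - L) / ((√(K : ℝ) / 2) * √(K : ℝ) * √(K : ℝ)) := by
      gcongr
      · linarith
      · linarith
    _ = _ := by
      rw [show √(K : ℝ) / 2 * √(K : ℝ) * √(K : ℝ) = √(K : ℝ) ^ 2 * √(K : ℝ) / 2 by ring, qK,
        div_div_eq_mul_div, mul_comm (2 : ℝ)]

/-- A block length that is logarithmic in `K`. -/
def blockLen (g K : ℕ) : ℕ := 3 * (Nat.log g K + 1)

lemma pow_three_le_pow_blockLen {g : ℕ} (hg : 1 < g) (K : ℕ) : K ^ 3 ≤ g ^ blockLen g K := by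
  rw [blockLen, mul_comm, pow_mul]
  exact Nat.pow_le_pow_left (Nat.lt_pow_succ_log_self hg K).le 3

lemma one_le_log_of_three_le {x : ℝ} (hx : 3 ≤ x) : 1 ≤ Real.log x := by
  rw [Real.le_log_iff_exp_le (by linarith)]
  linarith [Real.exp_one_lt_d9]

lemma blockLen_le {g : ℕ} (hg : 3 ≤ g) {K : ℕ} (hK : 3 ≤ K) :
    (blockLen g K : ℝ) ≤ 6 * Real.log K := by
  have h1 : 1 ≤ Real.log K := one_le_log_of_three_le (by exact_mod_cast hK)
  have h2 : 1 ≤ Real.log g := one_le_log_of_three_le (by exact_mod_cast hg)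
  have h3 : (Nat.log g K : ℝ) * Real.log g ≤ Real.log K := by
    rw [← Real.log_pow]
    apply Real.log_le_log (by positivity)
    exact_mod_cast Nat.pow_log_le_self g (by omega)
  have h4 : (Nat.log g K : ℝ) ≤ Real.log K := by
    have : (0 : ℝ) ≤ Nat.log g K := by positivity
    nlinarith
  rw [blockLen]
  push_cast
  linarith

lemma eventually_mul_log_le (a : ℝ) : ∀ᶠ K : ℕ in Filter.atTop, a * Real.log K ≤ K := by
  have h := (Real.isLittleO_log_id_atTop.const_mul_left a).bound one_pos
  have h' := (tendsto_natCast_atTop_atTop (R := ℝ)).eventually h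
  filter_upwards [h'] with K hK
  have := (le_abs_self _).trans hK
  simpa using this

/-- Near the origin, `fsum` is a rescaled Dirichlet kernel. -/
lemma exists_norm_fsum_sub_le {g : ℕ} (hg : 3 ≤ g) (B : ℝ) :
    ∃ C : ℝ, 0 < C ∧ ∃ K0 : ℕ, ∀ K : ℕ, K0 ≤ K → ∀ k : ℤ, |(k : ℝ) - muK g K| ≤ B →
      ∀ β : ℝ, |β| ≤ K / (g : ℝ) ^ K →
        ‖fsum g K k β - digitDensity g K * ∑ n ∈ Finset.range (g ^ K), eC ((n : ℝ) * β)‖ ≤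
          C * (g : ℝ) ^ K * (Real.log K ^ 2 / (K * √K)) := by
  obtain ⟨C, hC, hcard⟩ := exists_abs_card_Sset_sub_le (g := g) (by omega)
  have hg3 : (3 : ℝ) ≤ g := by exact_mod_cast hg
  have hpi := Real.pi_pos
  obtain ⟨K1, hK1⟩ := Filter.eventually_atTop.1 (eventually_mul_log_le 12)
  refine ⟨2 * Real.pi + (4 * C * (1 + (B + 12 * g) ^ 2) + 12), by positivity, max K1 4,
    fun K hK k hk β hβ => ?_⟩
  have hK4 : 4 ≤ K := (le_max_right _ _).trans hK
  have hK0 : (0 : ℝ) < K := by positivity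
  have hK4' : (4 : ℝ) ≤ K := by exact_mod_cast hK4
  have hlog := hK1 K ((le_max_left _ _).trans hK)
  have hB : 0 ≤ B := (abs_nonneg _).trans hk
  have ht6 := blockLen_le hg (K := K) (by omega)
  have hl1 : 1 ≤ Real.log K := one_le_log_of_three_le (by linarith)
  have hpow := pow_three_le_pow_blockLen (g := g) (by omega) K
  generalize blockLen g K = t at ht6 hpow
  have ht2 : 2 * t ≤ K := by
    have : (2 : ℝ) * t ≤ K := by linarith
    exact_mod_cast this
  obtain ⟨L, rfl⟩ : ∃ L, K = L + t := ⟨K - t, by omega⟩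
  have hL2 : 2 ≤ L := by omega
  have hL0 : (0 : ℝ) < L := by positivity
  set K : ℕ := L + t with hKdef
  set l : ℝ := Real.log K with hl
  have hKL : (K : ℝ) ≤ 2 * L := by
    have : K ≤ 2 * L := by omega
    exact_mod_cast this
  have hKt : (K : ℝ) - L = t := by rw [hKdef]; push_cast; ring
  have ht0 : (0 : ℝ) ≤ t := by positivity
  have hsK : 0 < √(K : ℝ) := Real.sqrt_pos.2 hK0
  have hsK1 : √(K : ℝ) ≤ K := by
    rw [Real.sqrt_le_left hK0.le]; nlinarith
  have hs2 : √(K : ℝ) ≤ 2 * √(L : ℝ) := by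
    rw [Real.sqrt_le_left (by positivity), mul_pow, Real.sq_sqrt hL0.le]; linarith
  have hρ1 : digitDensity g K ≤ 1 := by
    refine (digitDensity_le hg (by omega)).trans ?_
    rw [div_le_one hsK]
    exact Real.one_le_sqrt.2 (by linarith)
  have hmain := norm_fsum_sub_le_of_blocks (g := g) (by omega) (L := L) (t := t) (k := k)
    (ρ := digitDensity g K) (Q := (4 * C * (1 + (B + 12 * g) ^ 2) + 12) * (l ^ 2 / (K * √K)))
    (digitDensity_nonneg g K) hρ1 (fun a ha => ?_) β
  · refine hmain.trans ?_
    have hβ' : (g : ℝ) ^ L * |β| ≤ l ^ 2 / (K * √K) := by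
      have hp : (K : ℝ) ^ 3 ≤ (g : ℝ) ^ t := by exact_mod_cast hpow
      calc (g : ℝ) ^ L * |β| ≤ (g : ℝ) ^ L * (K / (g : ℝ) ^ K) := by gcongr
        _ = K / (g : ℝ) ^ t := by rw [hKdef, pow_add]; field_simp
        _ ≤ K / (K : ℝ) ^ 3 := by gcongr
        _ = 1 ^ 2 / (K * K) := by field_simp
        _ ≤ _ := by gcongr
    calc (g : ℝ) ^ K * (2 * Real.pi * ((g : ℝ) ^ L * |β|) +
          (4 * C * (1 + (B + 12 * g) ^ 2) + 12) * (l ^ 2 / (K * √K)))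
        ≤ (g : ℝ) ^ K * (2 * Real.pi * (l ^ 2 / (K * √K)) +
          (4 * C * (1 + (B + 12 * g) ^ 2) + 12) * (l ^ 2 / (K * √K))) := by gcongr
      _ = _ := by ring
  · have hc := hcard L hL2 (k - digitSum g a)
    have hd : (digitSum g a : ℝ) ≤ g * t := by
      have := digitSum_le (g := g) (by omega) t ha
      calc (digitSum g a : ℝ) ≤ (((g - 1) * t : ℕ) : ℝ) := by exact_mod_cast this
        _ ≤ ((g * t : ℕ) : ℝ) := by gcongr; omega
        _ = _ := by push_cast; ring
    have hd0 : (0 : ℝ) ≤ digitSum g a := by positivity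
    have hδ : |((k - digitSum g a : ℤ) : ℝ) - muK g L| ≤ (B + 12 * g) * l := by
      have hmu : muK g K = muK g L + (g - 1) * t / 2 := by
        simp only [muK, hKdef]; push_cast; ring
      have hgt : (g : ℝ) * t ≤ g * (6 * l) := by gcongr
      have hBl : B ≤ B * l := le_mul_of_one_le_right hB hl1
      have hgl : 0 ≤ (g : ℝ) * l := by positivity
      have := abs_le.1 hk
      rw [abs_le]
      push_cast
      constructor <;> nlinarith
    have hδ2 : 1 + (((k - digitSum g a : ℤ) : ℝ) - muK g L) ^ 2 ≤
        (1 + (B + 12 * g) ^ 2) * l ^ 2 := by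
      have h1 : (((k - digitSum g a : ℤ) : ℝ) - muK g L) ^ 2 ≤ ((B + 12 * g) * l) ^ 2 := by
        rw [← sq_abs]; gcongr
      nlinarith
    have hLL : K * √(K : ℝ) / 4 ≤ L * √(L : ℝ) := by
      calc K * √(K : ℝ) / 4 ≤ 2 * L * (2 * √(L : ℝ)) / 4 := by gcongr
        _ = _ := by ring
    have h1 : C * (1 + (((k - digitSum g a : ℤ) : ℝ) - muK g L) ^ 2) / (L * √L) ≤
        4 * C * (1 + (B + 12 * g) ^ 2) * (l ^ 2 / (K * √K)) := by
      calc _ ≤ C * ((1 + (B + 12 * g) ^ 2) * l ^ 2) / (K * √(K : ℝ) / 4) := by gcongr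
        _ = _ := by field_simp
    have h2 := abs_digitDensity_sub_le hg (L := L) (K := K) (by omega) (by omega) (by omega)
    have h3 : 2 * ((K : ℝ) - L) / (K * √K) ≤ 12 * (l ^ 2 / (K * √K)) := by
      rw [hKt, ← mul_div_assoc]
      refine div_le_div_of_nonneg_right ?_ (by positivity)
      nlinarith
    calc _ ≤ _ := abs_sub_le _ (digitDensity g L) _
      _ ≤ C * (1 + (((k - digitSum g a : ℤ) : ℝ) - muK g L) ^ 2) / (L * √L) +
          2 * (K - L) / (K * √K) := add_le_add hc h2
      _ ≤ _ := by linarith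

/-! ### The Dirichlet kernel and the count of ordered sums -/

/-- The exponential sum over all naturals below `N`. -/
def dirichletSum (N : ℕ) (β : ℝ) : ℂ := ∑ n ∈ Finset.range N, eC ((n : ℝ) * β)

lemma continuous_dirichletSum (N : ℕ) : Continuous (dirichletSum N) := by
  unfold dirichletSum; fun_prop

lemma norm_dirichletSum_le (N : ℕ) (β : ℝ) : ‖dirichletSum N β‖ ≤ N := by
  refine (norm_sum_le_of_le _ fun n _ => (norm_eC _).le).trans (le_of_eq (by simp))

lemma eC_nat_mul (n : ℕ) (β : ℝ) : eC (n * β) = eC β ^ n := by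
  rw [eC, eC, ← Complex.exp_nat_mul]; congr 1; push_cast; ring

lemma norm_dirichletSum_le_inv (N : ℕ) {β : ℝ} (h0 : β ≠ 0) (h : |β| ≤ 1 / 2) :
    ‖dirichletSum N β‖ ≤ 1 / (2 * |β|) := by
  have hβ : 0 < |β| := abs_pos.2 h0
  have hpi := Real.pi_pos
  have h1 : dirichletSum N β * (eC β - 1) = eC β ^ N - 1 := by
    simp only [dirichletSum, eC_nat_mul]
    exact geom_sum_mul _ _
  have h2 : 4 * |β| ≤ ‖eC β - 1‖ := by
    rw [eC_eq, mul_comm _ Complex.I, Complex.norm_exp_I_mul_ofReal_sub_one, norm_mul, Real.norm_eq_abs,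
      Real.norm_eq_abs, abs_two, show 2 * Real.pi * β / 2 = Real.pi * β by ring]
    have := Real.mul_abs_le_abs_sin (x := Real.pi * β)
      (by rw [abs_mul, abs_of_pos hpi]; nlinarith)
    rw [abs_mul, abs_of_pos hpi] at this
    have e : 2 / Real.pi * (Real.pi * |β|) = 2 * |β| := by field_simp
    linarith
  have h3 : ‖eC β ^ N - 1‖ ≤ 2 := by
    refine (norm_sub_le _ _).trans ?_
    rw [norm_pow, norm_eC, one_pow, norm_one]
    norm_num
  rw [← h1, norm_mul] at h3
  rw [le_div_iff₀ (by positivity)]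
  nlinarith [mul_le_mul_of_nonneg_left h2 (norm_nonneg (dirichletSum N β))]

lemma integral_eC_int_mul (m : ℤ) :
    ∫ β in (-(1 / 2) : ℝ)..(1 / 2), eC ((m : ℝ) * β) = if m = 0 then 1 else 0 := by
  split_ifs with h
  · subst h
    have : ∀ β : ℝ, eC (((0 : ℤ) : ℝ) * β) = 1 := fun β => by simp [eC]
    simp only [this]
    simp
    norm_num
  · have hm : (m : ℂ) ≠ 0 := by exact_mod_cast h
    have hc : 2 * Real.pi * Complex.I * m ≠ 0 :=
      mul_ne_zero Complex.two_pi_I_ne_zero hm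
    have : ∀ β : ℝ, eC ((m : ℝ) * β) = Complex.exp (2 * Real.pi * Complex.I * m * β) :=
      fun β => by rw [eC]; congr 1; push_cast; ring
    simp only [this]
    rw [integral_exp_mul_complex hc, div_eq_zero_iff]
    left
    rw [sub_eq_zero, Complex.exp_eq_exp_iff_exists_int]
    exact ⟨m, by push_cast; ring⟩

/-- Ordered triples below `N` with sum `M`. -/
def tripleCount (N M : ℕ) : ℕ :=
  ∑ a ∈ Finset.range N,
    ((Finset.range N ×ˢ Finset.range N).filter fun p => a + p.1 + p.2 = M).card

lemma integral_dirichletSum_cube (N M : ℕ) :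
    ∫ β in (-(1 / 2) : ℝ)..(1 / 2), dirichletSum N β ^ 3 * eC (-(M : ℝ) * β) =
      tripleCount N M := by
  have e : ∀ β : ℝ, dirichletSum N β ^ 3 * eC (-(M : ℝ) * β) =
      ∑ a ∈ Finset.range N, ∑ p ∈ Finset.range N ×ˢ Finset.range N,
        eC (((a + p.1 + p.2 - M : ℤ) : ℝ) * β) := by
    intro β
    rw [pow_succ', sq, mul_assoc, dirichletSum, Finset.sum_mul]
    refine Finset.sum_congr rfl fun a _ => ?_
    rw [Finset.sum_mul_sum, ← Finset.sum_product', Finset.sum_mul, Finset.mul_sum]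
    refine Finset.sum_congr rfl fun p _ => ?_
    rw [← eC_add, ← eC_add, ← eC_add]
    congr 1
    push_cast
    ring
  simp only [e]
  rw [intervalIntegral.integral_finsetSum]
  · rw [tripleCount, Nat.cast_sum]
    refine Finset.sum_congr rfl fun a _ => ?_
    rw [intervalIntegral.integral_finsetSum]
    · simp only [integral_eC_int_mul]
      rw [← Finset.sum_filter, Finset.sum_const, nsmul_eq_mul, mul_one]
      congr 2
      refine Finset.filter_congr fun p _ => ?_
      omega
    · intro p _
      exact Continuous.intervalIntegrable (by fun_prop) _ _
  · intro a _
    exact Continuous.intervalIntegrable (by fun_prop) _ _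

lemma two_mul_sum_range_sub (m : ℕ) : 2 * ∑ a ∈ Finset.range m, (m - a) = m * (m + 1) := by
  induction m with
  | zero => simp
  | succ m ih =>
    rw [Finset.sum_range_succ']
    simp only [Nat.add_sub_add_right]
    rw [mul_add, ih]
    simp only [Nat.sub_zero]
    ring

lemma two_mul_tripleCount_le (N M : ℕ) : 2 * tripleCount N M ≤ (M + 1) * (M + 2) := by
  rw [← two_mul_sum_range_sub (M + 1)]
  refine Nat.mul_le_mul_left 2 ?_
  refine (Finset.sum_le_sum (g := fun a => M + 1 - a) fun a _ => ?_).trans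
    (Finset.sum_le_sum_of_ne_zero fun a _ h => ?_)
  · rw [← Finset.card_range (M + 1 - a)]
    refine Finset.card_le_card_of_injOn Prod.fst (fun p hp => ?_) (fun p hp q hq h => ?_)
    · simp at hp ⊢; omega
    · simp at hp hq; ext <;> omega
  · simp; omega

lemma le_two_mul_tripleCount {N M : ℕ} (hM : M ≤ N) : M * (M - 1) ≤ 2 * tripleCount N M := by
  rcases M with _ | m
  · simp
  rw [Nat.add_sub_cancel, mul_comm, ← two_mul_sum_range_sub m]
  refine Nat.mul_le_mul_left 2 ?_
  obtain ⟨N, rfl⟩ := Nat.exists_eq_add_of_le hM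
  rw [tripleCount, show m + 1 + N = (m + N) + 1 by ring, Finset.sum_range_succ']
  refine le_trans ?_ (Nat.le_add_right _ _)
  rw [Finset.sum_range_add]
  refine le_trans (Finset.sum_le_sum fun a ha => ?_) (Nat.le_add_right _ _)
  rw [← Finset.card_range (m - a)]
  have ha' := Finset.mem_range.1 ha
  refine Finset.card_le_card_of_injOn (fun b => (b, m - a - b)) (fun b hb => ?_)
    (fun b hb c hc h => ?_)
  · simp at hb ⊢; omega
  · simpa using congrArg Prod.fst h

lemma abs_tripleCount_sub_le {N M : ℕ} (h1 : 1 ≤ M) (hM : M ≤ N) :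
    |(tripleCount N M : ℝ) - (M : ℝ) ^ 2 / 2| ≤ 4 * (M : ℝ) := by
  have h1' : (1 : ℝ) ≤ M := by exact_mod_cast h1
  have hu : (2 : ℝ) * tripleCount N M ≤ (M + 1) * (M + 2) := by
    exact_mod_cast two_mul_tripleCount_le N M
  have hl : (M : ℝ) * (M - 1) ≤ 2 * tripleCount N M := by
    have := le_two_mul_tripleCount hM
    rw [← Nat.cast_one, ← Nat.cast_sub h1]
    exact_mod_cast this
  rw [abs_le]
  constructor <;> nlinarith

lemma norm_integral_tail_le {F : ℝ → ℂ} {ε : ℝ} (hε : 0 < ε) (hε2 : ε ≤ 1 / 2)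
    (hF : ∀ x, ε < x → x ≤ 1 / 2 → ‖F x‖ ≤ 1 / 8 * x ^ (-3 : ℤ)) :
    ‖∫ x in ε..(1 / 2), F x‖ ≤ 1 / (16 * ε ^ 2) := by
  have h0 : (0 : ℝ) ∉ Set.uIcc ε (1 / 2) := by
    rw [Set.uIcc_of_le hε2]; simp [hε]
  refine (intervalIntegral.norm_integral_le_of_norm_le hε2
    (g := fun x => 1 / 8 * x ^ (-3 : ℤ)) (Filter.Eventually.of_forall fun x hx => hF x hx.1 hx.2)
    ((intervalIntegral.intervalIntegrable_zpow (Or.inr h0)).const_mul _)).trans ?_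
  rw [intervalIntegral.integral_const_mul, integral_zpow (Or.inr ⟨by norm_num, h0⟩)]
  norm_num
  have : 0 < (ε ^ 2)⁻¹ := by positivity
  linarith

lemma norm_integral_dirichletSum_cube_sub_le {N M : ℕ} (h1 : 1 ≤ M) (hM : M ≤ N) {ε : ℝ}
    (hε : 0 < ε) (hε2 : ε ≤ 1 / 2) :
    ‖(∫ β in (-ε)..ε, dirichletSum N β ^ 3 * eC (-(M : ℝ) * β)) - ((M : ℂ) ^ 2 / 2)‖ ≤
      4 * M + 1 / (8 * ε ^ 2) := by
  set F : ℝ → ℂ := fun β => dirichletSum N β ^ 3 * eC (-(M : ℝ) * β) with hFdef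
  have hFc : Continuous F := by
    have := continuous_dirichletSum N
    fun_prop
  have hi : ∀ a b : ℝ, IntervalIntegrable F volume a b := fun a b => hFc.intervalIntegrable a b
  have hFle : ∀ x : ℝ, ε < |x| → |x| ≤ 1 / 2 → ‖F x‖ ≤ 1 / 8 * |x| ^ (-3 : ℤ) := by
    intro x hx hx2
    have hx0 : 0 < |x| := hε.trans hx
    rw [hFdef]
    simp only
    rw [norm_mul, norm_eC, mul_one, norm_pow]
    calc _ ≤ (1 / (2 * |x|)) ^ 3 := by
          gcongr; exact norm_dirichletSum_le_inv N (abs_pos.1 hx0) hx2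
      _ = _ := by
          rw [zpow_neg, div_pow, mul_pow]
          norm_cast
          field_simp
          norm_num
  have hr := norm_integral_tail_le (F := F) hε hε2 fun x h1 h2 => by
    have hx : |x| = x := abs_of_pos (hε.trans h1)
    simpa [hx] using hFle x (by rwa [hx]) (by rwa [hx])
  have hl := norm_integral_tail_le (F := fun x => F (-x)) hε hε2 fun x h1 h2 => by
    have hx : |-x| = x := by rw [abs_neg]; exact abs_of_pos (hε.trans h1)
    have := hFle (-x) (by rwa [hx]) (by rwa [hx])
    rwa [hx] at this
  rw [intervalIntegral.integral_comp_neg] at hl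
  have hsplit : (∫ β in (-ε)..ε, F β) - ((M : ℂ) ^ 2 / 2) =
      (((tripleCount N M : ℝ) - (M : ℝ) ^ 2 / 2 : ℝ) : ℂ) -
        (∫ β in (-(1 / 2) : ℝ)..(-ε), F β) - ∫ β in ε..(1 / 2), F β := by
    have h := integral_dirichletSum_cube N M
    rw [← intervalIntegral.integral_add_adjacent_intervals (hi _ (-ε)) (hi _ _),
      ← intervalIntegral.integral_add_adjacent_intervals (hi (-ε) ε) (hi _ _)] at h
    push_cast
    rw [← h]
    ring
  rw [hsplit]
  have ht := abs_tripleCount_sub_le h1 hM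
  rw [← Real.norm_eq_abs, ← Complex.norm_real] at ht
  calc _ ≤ _ := norm_sub_le _ _
    _ ≤ _ := add_le_add_left (norm_sub_le _ _) _
    _ ≤ 4 * M + 1 / (16 * ε ^ 2) + 1 / (16 * ε ^ 2) := add_le_add (add_le_add ht hl) hr
    _ = _ := by field_simp; ring

/-! ### Reduction of the major arcs to a neighbourhood of the origin -/

lemma continuous_fsum (g K : ℕ) (k : ℤ) : Continuous (fsum g K k) := by
  unfold fsum; fun_prop

lemma fsum_add_div {g : ℕ} (hg : 3 ≤ g) (K : ℕ) (k : ℤ) (j : ℕ) (β : ℝ) :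
    fsum g K k (j / ((g : ℝ) - 1) + β) = eC (k * j / ((g : ℝ) - 1)) * fsum g K k β := by
  have hg1 : (g : ℝ) - 1 ≠ 0 := by
    have : (3 : ℝ) ≤ g := by exact_mod_cast hg
    linarith
  rw [fsum, fsum, Finset.mul_sum]
  refine Finset.sum_congr rfl fun n hn => ?_
  have hk : (digitSum g n : ℤ) = k := (Finset.mem_filter.1 hn).2
  have hmod : n ≡ digitSum g n [MOD (g - 1)] := by
    refine Nat.modEq_digits_sum (g - 1) g ?_ n
    rw [Nat.mod_eq_sub_mod (by omega), show g - (g - 1) = 1 by omega, Nat.mod_eq_of_lt (by omega)]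
  obtain ⟨q, hq⟩ := (Nat.modEq_iff_dvd.1 hmod.symm)
  rw [hk] at hq
  have hq' : (n : ℝ) = k + (g - 1) * q := by
    have : (n : ℤ) = k + ((g - 1 : ℕ) : ℤ) * q := by linarith
    have h := congrArg (fun z : ℤ => (z : ℝ)) this
    push_cast [Nat.cast_sub (show 1 ≤ g by omega)] at h
    exact h
  have e : (n : ℝ) * (j / ((g : ℝ) - 1) + β) =
      k * j / ((g : ℝ) - 1) + ((q * j : ℤ) : ℝ) + n * β := by
    rw [mul_add]
    conv_lhs => enter [1, 1]; rw [hq']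
    push_cast
    field_simp
  rw [e, eC_add, eC_add, eC_int, mul_one]

lemma integral_majorArcs {g K : ℕ} (hg : 3 ≤ g) (hε0 : 0 < epsK g K)
    (hε : 2 * epsK g K * ((g : ℝ) - 1) < 1) {F : ℝ → ℂ} (hF : Continuous F)
    (hper : ∀ (j : ℕ) (β : ℝ), F (j / ((g : ℝ) - 1) + β) = F β) :
    ∫ θ in majorArcs g K, F θ = ((g : ℝ) - 1 : ℝ) * ∫ β in (-epsK g K)..epsK g K, F β := by
  have hg1 : 0 < (g : ℝ) - 1 := by
    have : (3 : ℝ) ≤ g := by exact_mod_cast hg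
    linarith
  have hlt : ∀ i j : ℕ, i < j →
      (i : ℝ) / ((g : ℝ) - 1) + epsK g K < (j : ℝ) / ((g : ℝ) - 1) - epsK g K := by
    intro i j hij
    have hij' : (i : ℝ) + 1 ≤ j := by exact_mod_cast hij
    have : (i : ℝ) / ((g : ℝ) - 1) + 1 / ((g : ℝ) - 1) ≤ j / ((g : ℝ) - 1) := by
      rw [← add_div]; gcongr
    have h2 : 2 * epsK g K < 1 / ((g : ℝ) - 1) := by rwa [lt_div_iff₀ hg1]
    linarith
  rw [majorArcs, integral_biUnion_finset _ (fun _ _ => measurableSet_Icc)]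
  · rw [Finset.sum_congr rfl (g := fun _ => ∫ β in (-epsK g K)..epsK g K, F β)]
    · rw [Finset.sum_const, Finset.card_range, nsmul_eq_mul, Nat.cast_sub (by omega)]
      push_cast
      rfl
    · intro j _
      rw [integral_Icc_eq_integral_Ioc, ← intervalIntegral.integral_of_le (by linarith)]
      have h : ∫ β in (-epsK g K)..epsK g K, F β =
          ∫ β in (-epsK g K)..epsK g K, F (j / ((g : ℝ) - 1) + β) :=
        intervalIntegral.integral_congr fun β _ => (hper j β).symm
      rw [h, intervalIntegral.integral_comp_add_left, ← sub_eq_add_neg]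
  · intro i _ j _ hij
    rw [Function.onFun, Set.disjoint_left]
    rintro x ⟨h1, h2⟩ ⟨h3, h4⟩
    rcases lt_or_gt_of_ne hij with h | h
    · linarith [hlt _ _ h]
    · linarith [hlt _ _ h]
  · intro j _
    exact hF.continuousOn.integrableOn_Icc

/-! ### The major arc estimate -/

lemma norm_mul_mul_sub_cube_le {a b c p : ℂ} {E Q : ℝ} (ha : ‖a - p‖ ≤ E) (hb : ‖b - p‖ ≤ E)
    (hc : ‖c - p‖ ≤ E) (hb' : ‖b‖ ≤ Q) (hc' : ‖c‖ ≤ Q) (hp : ‖p‖ ≤ Q) :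
    ‖a * b * c - p ^ 3‖ ≤ 3 * E * Q ^ 2 := by
  have hE : 0 ≤ E := (norm_nonneg _).trans ha
  have hQ : 0 ≤ Q := (norm_nonneg _).trans hp
  have e : a * b * c - p ^ 3 = (a - p) * (b * c) + (b - p) * (p * c) + (c - p) * (p * p) := by ring
  rw [e]
  refine (norm_add₃_le).trans ?_
  simp only [norm_mul]
  calc _ ≤ E * (Q * Q) + E * (Q * Q) + E * (Q * Q) := by gcongr
    _ = _ := by ring

lemma eventually_log_sq_le : ∀ᶠ K : ℕ in Filter.atTop, Real.log K ^ 2 ≤ K := by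
  have h := (Real.isLittleO_pow_log_id_atTop (n := 2)).bound one_pos
  filter_upwards [(tendsto_natCast_atTop_atTop (R := ℝ)).eventually h] with K hK
  have := (le_abs_self _).trans hK
  simpa using this

lemma epsK_bounds {g K : ℕ} (hg : 3 ≤ g) (hK : 1 ≤ K) :
    0 < epsK g K ∧ epsK g K ≤ K / (g : ℝ) ^ K ∧ epsK g K ≤ 1 / 2 ∧
      2 * epsK g K * ((g : ℝ) - 1) < 1 := by
  have hg3 : (3 : ℝ) ≤ g := by exact_mod_cast hg
  have hg1 : 0 < (g : ℝ) - 1 := by linarith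
  have hK1 : (1 : ℝ) ≤ K := by exact_mod_cast hK
  have hK0 : (0 : ℝ) < K := by linarith
  have hgK : (0 : ℝ) < (g : ℝ) ^ K := by positivity
  have h34 : (K : ℝ) ^ ((3 : ℝ) / 4) ≤ K := by
    calc _ ≤ (K : ℝ) ^ (1 : ℝ) := Real.rpow_le_rpow_of_exponent_le hK1 (by norm_num)
      _ = K := Real.rpow_one _
  have h2K : 2 * (K : ℝ) < (g : ℝ) ^ K := by
    have h : 1 + (K : ℝ) * 2 ≤ (1 + 2) ^ K := one_add_mul_le_pow (by norm_num) K
    have h' : ((1 : ℝ) + 2) ^ K ≤ (g : ℝ) ^ K := by gcongr; linarith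
    linarith
  have hpos : 0 < epsK g K := by unfold epsK; positivity
  have hmul : epsK g K * ((g : ℝ) - 1) ≤ K / (g : ℝ) ^ K := by
    rw [epsK, div_mul_cancel₀ _ hg1.ne', ← div_eq_mul_inv]
    gcongr
  have hhalf : (K : ℝ) / (g : ℝ) ^ K < 1 / 2 := by
    rw [div_lt_iff₀ hgK]; linarith
  have hle : epsK g K ≤ epsK g K * ((g : ℝ) - 1) :=
    le_mul_of_one_le_right hpos.le (by linarith)
  exact ⟨hpos, hle.trans hmul, by linarith, by linarith⟩


/-- The error terms of the major arc estimate, in terms of `r = √K`, `T = K ^ (3/4)` and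
`1 / (K * T) = K ^ (-7/4)`. -/
lemma major_arc_error_le {g N M K C l ε r T : ℝ} (hg : 1 < g) (hN : 0 < N) (hNM : N ≤ g * M)
    (hK : 1 ≤ K) (hKM : K ≤ M) (hl : 1 ≤ l) (hC : 0 ≤ C) (hr : 0 < r) (hr2 : r ^ 2 = K)
    (hT : 1 ≤ T) (hT2 : T ^ 2 = K * r) (hε : ε = T / N / (g - 1)) :
    (g - 1) * (3 * (C * N * (l ^ 2 / (K * r))) * ((1 + C) * (N / r)) ^ 2 * (2 * ε) +
        (1 / r) ^ 3 * (4 * M + 1 / (8 * ε ^ 2))) ≤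
      (6 * C * (1 + C) ^ 2 * g ^ 2 + (g - 1) * 4 + (g - 1) ^ 3 * g ^ 2 / 8) * M ^ 2 * l ^ 4 *
        (1 / (K * T)) := by
  have hG : 0 < g - 1 := by linarith
  have hK0 : 0 < K := by linarith
  have hT0 : 0 < T := by linarith
  have hM0 : 0 < M := by linarith
  have hr1 : 1 ≤ r := by
    by_contra h
    nlinarith
  have hl4 : 1 ≤ l ^ 4 := one_le_pow₀ hl
  have hl24 : l ^ 2 ≤ l ^ 4 := pow_le_pow_right₀ hl (by norm_num)
  have hN2 : N ^ 2 ≤ g ^ 2 * M ^ 2 := by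
    rw [← mul_pow]; gcongr
  have hr3 : (1 / r) ^ 3 = 1 / T ^ 2 := by
    rw [hT2, ← hr2]; field_simp
  have e1 : (g - 1) * (3 * (C * N * (l ^ 2 / (K * r))) * ((1 + C) * (N / r)) ^ 2 * (2 * ε)) =
      6 * C * (1 + C) ^ 2 * (N ^ 2 * l ^ 2 * (1 / (K * T))) := by
    rw [mul_pow, div_pow, hr2, ← hT2, hε]
    field_simp
    ring
  have e2 : (g - 1) * (1 / T ^ 2 * (4 * M)) ≤ (g - 1) * 4 * (M ^ 2 * l ^ 4 * (1 / (K * T))) := by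
    have h : 1 / T ^ 2 ≤ M * l ^ 4 * (1 / (K * T)) := by
      rw [mul_one_div, div_le_div_iff₀ (by positivity) (by positivity)]
      calc 1 * (K * T) ≤ M * 1 * (T * T) := by nlinarith [mul_pos hM0 hT0]
        _ ≤ M * l ^ 4 * T ^ 2 := by rw [sq]; gcongr
    calc _ ≤ (g - 1) * (M * l ^ 4 * (1 / (K * T)) * (4 * M)) := by gcongr
      _ = _ := by ring
  have e3 : (g - 1) * (1 / T ^ 2 * (1 / (8 * ε ^ 2))) ≤
      (g - 1) ^ 3 / 8 * (g ^ 2 * M ^ 2 * l ^ 4 * (1 / (K * T))) := by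
    have h : 1 / T ^ 4 ≤ l ^ 4 * (1 / (K * T)) := by
      rw [mul_one_div, div_le_div_iff₀ (by positivity) (by positivity)]
      calc 1 * (K * T) ≤ 1 * (K * r * T * T) := by
            nlinarith [mul_pos hK0 hT0, mul_le_mul hr1 hT zero_le_one hr.le]
        _ = 1 * T ^ 4 := by rw [← hT2]; ring
        _ ≤ l ^ 4 * T ^ 4 := by gcongr
    calc _ = (g - 1) ^ 3 / 8 * (N ^ 2 * (1 / T ^ 4)) := by
          rw [hε]
          field_simp
      _ ≤ (g - 1) ^ 3 / 8 * (g ^ 2 * M ^ 2 * (l ^ 4 * (1 / (K * T)))) := by gcongr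
      _ = _ := by ring
  have e1' : 6 * C * (1 + C) ^ 2 * (N ^ 2 * l ^ 2 * (1 / (K * T))) ≤
      6 * C * (1 + C) ^ 2 * (g ^ 2 * M ^ 2 * l ^ 4 * (1 / (K * T))) := by gcongr
  rw [mul_add, e1, hr3]
  linear_combination e1' + e2 + e3
theorem statement6 (g : ℕ) (hg : 3 ≤ g) :
    ∃ c : ℝ, 0 < c ∧ ∃ K0 : ℕ, ∀ K : ℕ, K0 ≤ K →
      ∀ M : ℕ, g ^ (K - 1) < M → M ≤ g ^ K →
      ∀ k1 k2 k3 : ℤ,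
        |(k1 : ℝ) - muK g K| ≤ Cg g →
        |(k2 : ℝ) - muK g K| ≤ Cg g →
        |(k3 : ℝ) - muK g K| ≤ Cg g →
        k1 + k2 + k3 ≡ (M : ℤ) [ZMOD ((g : ℤ) - 1)] →
        ‖(∫ θ in majorArcs g K,
              fsum g K k1 θ * fsum g K k2 θ * fsum g K k3 θ * eC (-(M : ℝ) * θ)) -
            ((((g : ℝ) - 1) * (M : ℝ) ^ 2 /
                (2 * (2 * Real.pi * (((g : ℝ) ^ 2 - 1) / 12) * K) ^ ((3 : ℝ) / 2)) : ℝ) : ℂ)‖ ≤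
          c * (M : ℝ) ^ 2 * Real.log K ^ 4 * (K : ℝ) ^ (-(7 : ℝ) / 4) := by
  obtain ⟨C, hC, K1, hf⟩ := exists_norm_fsum_sub_le hg (Cg g)
  obtain ⟨K2, hK2⟩ := Filter.eventually_atTop.1 eventually_log_sq_le
  have hg3 : (3 : ℝ) ≤ g := by exact_mod_cast hg
  have hg1 : 0 < (g : ℝ) - 1 := by linarith
  refine ⟨6 * C * (1 + C) ^ 2 * (g : ℝ) ^ 2 + ((g : ℝ) - 1) * 4 +
    ((g : ℝ) - 1) ^ 3 * (g : ℝ) ^ 2 / 8, by positivity, max (max K1 K2) 3,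
    fun K hK M hM1 hM2 k1 k2 k3 hk1 hk2 hk3 hmod => ?_⟩
  have hK3 : 3 ≤ K := (le_max_right _ _).trans hK
  have hKK1 : K1 ≤ K := (le_max_left _ _).trans ((le_max_left _ _).trans hK)
  have hlogK := hK2 K ((le_max_right _ _).trans ((le_max_left _ _).trans hK))
  have hK3' : (3 : ℝ) ≤ K := by exact_mod_cast hK3
  have hK0 : (0 : ℝ) < K := by linarith
  have hl1 : 1 ≤ Real.log K := one_le_log_of_three_le hK3'
  obtain ⟨hε0, hεK, hεhalf, hεg⟩ := epsK_bounds hg (K := K) (by omega)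
  have hM0 : 1 ≤ M := by omega
  have hM0' : (1 : ℝ) ≤ M := by exact_mod_cast hM0
  set N : ℕ := g ^ K with hN
  have hNr : (N : ℝ) = (g : ℝ) ^ K := by rw [hN]; push_cast; rfl
  have hN0 : (0 : ℝ) < N := by rw [hNr]; positivity
  have hNM : (N : ℝ) ≤ g * M := by
    obtain ⟨m, rfl⟩ := Nat.exists_eq_add_of_le' (show 1 ≤ K by omega)
    rw [hNr, pow_succ, mul_comm]
    gcongr
    exact_mod_cast hM1.le
  have hKM : (K : ℝ) ≤ M := by
    have : K - 1 < g ^ (K - 1) := Nat.lt_pow_self (by omega)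
    have : K ≤ M := by omega
    exact_mod_cast this
  set l : ℝ := Real.log K with hl
  set ε : ℝ := epsK g K with hεdef
  set ρ : ℝ := digitDensity g K with hρ
  have hρ0 : 0 ≤ ρ := digitDensity_nonneg g K
  have hρ1 : ρ ≤ 1 / √(K : ℝ) := digitDensity_le hg (by omega)
  have hsK : 0 < √(K : ℝ) := Real.sqrt_pos.2 hK0
  have hsq : √(K : ℝ) ^ 2 = K := Real.sq_sqrt hK0.le
  set F : ℝ → ℂ := fun θ =>
    fsum g K k1 θ * fsum g K k2 θ * fsum g K k3 θ * eC (-(M : ℝ) * θ) with hF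
  have hFc : Continuous F := by
    have h1 := continuous_fsum g K k1
    have h2 := continuous_fsum g K k2
    have h3 := continuous_fsum g K k3
    fun_prop
  have hper : ∀ (j : ℕ) (β : ℝ), F (j / ((g : ℝ) - 1) + β) = F β := by
    intro j β
    obtain ⟨q, hq⟩ := hmod.symm.dvd
    have hq' : (k1 : ℝ) + k2 + k3 - M = (g - 1) * q := by exact_mod_cast hq
    have he : eC (k1 * j / ((g : ℝ) - 1)) * eC (k2 * j / ((g : ℝ) - 1)) *
        eC (k3 * j / ((g : ℝ) - 1)) * eC (-(M : ℝ) * (j / ((g : ℝ) - 1))) = 1 := by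
      rw [← eC_add, ← eC_add, ← eC_add, ← eC_int (q * j)]
      congr 1
      calc _ = ((k1 : ℝ) + k2 + k3 - M) * j / ((g : ℝ) - 1) := by ring
        _ = _ := by
          rw [hq']
          push_cast
          field_simp
    simp only [hF, fsum_add_div hg, mul_add (-(M : ℝ)), eC_add]
    linear_combination (fsum g K k1 β * fsum g K k2 β * fsum g K k3 β * eC (-(M : ℝ) * β)) * he
  rw [integral_majorArcs hg hε0 hεg hFc hper]
  -- the pointwise comparison with the Dirichlet kernel
  set E : ℝ := C * N * (l ^ 2 / (K * √K)) with hE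
  set Q : ℝ := (1 + C) * (N / √(K : ℝ)) with hQ
  have hEQ : E ≤ C * (N / √(K : ℝ)) := by
    calc E ≤ C * N * (K / (K * √K)) := by rw [hE]; gcongr
      _ = _ := by field_simp
  have hp : ∀ β, ‖(ρ : ℂ) * dirichletSum N β‖ ≤ N / √(K : ℝ) := by
    intro β
    rw [norm_mul, Complex.norm_real, Real.norm_of_nonneg hρ0]
    calc _ ≤ 1 / √(K : ℝ) * N := by gcongr; exact norm_dirichletSum_le N β
      _ = _ := by ring
  have hpQ : ∀ β, ‖(ρ : ℂ) * dirichletSum N β‖ ≤ Q := fun β => (hp β).trans (by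
    have : 0 ≤ C * (N / √(K : ℝ)) := by positivity
    rw [hQ]; linarith)
  have hcmp : ∀ k : ℤ, |(k : ℝ) - muK g K| ≤ Cg g → ∀ β, |β| ≤ ε →
      ‖fsum g K k β - ρ * dirichletSum N β‖ ≤ E := by
    intro k hk β hβ
    rw [hE, hNr]
    exact hf K hKK1 k hk β (hβ.trans hεK)
  have hfQ : ∀ k : ℤ, |(k : ℝ) - muK g K| ≤ Cg g → ∀ β, |β| ≤ ε → ‖fsum g K k β‖ ≤ Q := by
    intro k hk β hβ
    have h1 := hcmp k hk β hβ
    have h2 := norm_le_norm_add_norm_sub (ρ * dirichletSum N β : ℂ) (fsum g K k β)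
    have h3 := hp β
    rw [norm_sub_rev] at h2
    rw [hQ]
    linarith
  have hdiff : ‖(∫ β in (-ε)..ε, F β) -
      (ρ : ℂ) ^ 3 * ∫ β in (-ε)..ε, dirichletSum N β ^ 3 * eC (-(M : ℝ) * β)‖ ≤
      3 * E * Q ^ 2 * (2 * ε) := by
    have hDc := continuous_dirichletSum N
    rw [← intervalIntegral.integral_const_mul, ← intervalIntegral.integral_sub
      (hFc.intervalIntegrable _ _) (Continuous.intervalIntegrable (by fun_prop) _ _)]
    refine (intervalIntegral.norm_integral_le_of_norm_le_const (C := 3 * E * Q ^ 2)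
      fun β hβ => ?_).trans (le_of_eq ?_)
    · rw [Set.uIoc_of_le (by linarith)] at hβ
      have hβ' : |β| ≤ ε := abs_le.2 ⟨hβ.1.le, hβ.2⟩
      have e : F β - (ρ : ℂ) ^ 3 * (dirichletSum N β ^ 3 * eC (-(M : ℝ) * β)) =
          (fsum g K k1 β * fsum g K k2 β * fsum g K k3 β - (ρ * dirichletSum N β) ^ 3) *
            eC (-(M : ℝ) * β) := by
        rw [hF]; ring
      rw [e, norm_mul, norm_eC, mul_one]
      exact norm_mul_mul_sub_cube_le (hcmp k1 hk1 β hβ') (hcmp k2 hk2 β hβ') (hcmp k3 hk3 β hβ')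
        (hfQ k2 hk2 β hβ') (hfQ k3 hk3 β hβ') (hpQ β)
    · rw [abs_of_nonneg (by linarith)]; ring
  have hmain := norm_integral_dirichletSum_cube_sub_le hM0 hM2 hε0 hεhalf
  have hρ3 : ((g : ℝ) - 1) * (M : ℝ) ^ 2 /
      (2 * (2 * Real.pi * (((g : ℝ) ^ 2 - 1) / 12) * K) ^ ((3 : ℝ) / 2)) =
      ((g : ℝ) - 1) * (ρ ^ 3 * ((M : ℝ) ^ 2 / 2)) := by
    have hv : 0 ≤ 2 * Real.pi * digitVar g * K := by
      have := one_le_two_pi_mul_digitVar hg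
      positivity
    have : (2 * Real.pi * (((g : ℝ) ^ 2 - 1) / 12) * K) ^ ((3 : ℝ) / 2) =
        √(2 * Real.pi * digitVar g * K) ^ 3 := by
      change (2 * Real.pi * digitVar g * K) ^ ((3 : ℝ) / 2) = _
      generalize 2 * Real.pi * digitVar g * (K : ℝ) = y at hv ⊢
      rw [Real.sqrt_eq_rpow, ← Real.rpow_natCast, ← Real.rpow_mul hv]
      norm_num
    rw [this, hρ, digitDensity, div_pow, one_pow]
    ring
  have hsplit : (((g : ℝ) - 1 : ℝ) : ℂ) * (∫ β in (-ε)..ε, F β) -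
      ((((g : ℝ) - 1) * (M : ℝ) ^ 2 /
        (2 * (2 * Real.pi * (((g : ℝ) ^ 2 - 1) / 12) * K) ^ ((3 : ℝ) / 2)) : ℝ) : ℂ) =
      (((g : ℝ) - 1 : ℝ) : ℂ) * (((∫ β in (-ε)..ε, F β) -
        (ρ : ℂ) ^ 3 * ∫ β in (-ε)..ε, dirichletSum N β ^ 3 * eC (-(M : ℝ) * β)) +
        (ρ : ℂ) ^ 3 * ((∫ β in (-ε)..ε, dirichletSum N β ^ 3 * eC (-(M : ℝ) * β)) -
          (M : ℂ) ^ 2 / 2)) := by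
    rw [hρ3]
    push_cast
    ring
  rw [hsplit, norm_mul, Complex.norm_real, Real.norm_of_nonneg hg1.le]
  have hbound : ‖((∫ β in (-ε)..ε, F β) -
        (ρ : ℂ) ^ 3 * ∫ β in (-ε)..ε, dirichletSum N β ^ 3 * eC (-(M : ℝ) * β)) +
        (ρ : ℂ) ^ 3 * ((∫ β in (-ε)..ε, dirichletSum N β ^ 3 * eC (-(M : ℝ) * β)) -
          (M : ℂ) ^ 2 / 2)‖ ≤
      3 * E * Q ^ 2 * (2 * ε) + (1 / √(K : ℝ)) ^ 3 * (4 * M + 1 / (8 * ε ^ 2)) := by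
    refine (norm_add_le _ _).trans (add_le_add hdiff ?_)
    rw [norm_mul, norm_pow, Complex.norm_real, Real.norm_of_nonneg hρ0]
    gcongr
  refine (mul_le_mul_of_nonneg_left hbound hg1.le).trans ?_
  have hK1 : (1 : ℝ) ≤ K := by linarith
  have hX : (K : ℝ) ^ (-(7 : ℝ) / 4) = 1 / (K * (K : ℝ) ^ ((3 : ℝ) / 4)) := by
    rw [← Real.rpow_one_add' hK0.le (by norm_num), one_div, ← Real.rpow_neg hK0.le]
    norm_num
  have hT2 : ((K : ℝ) ^ ((3 : ℝ) / 4)) ^ 2 = K * √(K : ℝ) := by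
    rw [Real.sqrt_eq_rpow, ← Real.rpow_one_add' hK0.le (by norm_num), ← Real.rpow_natCast,
      ← Real.rpow_mul hK0.le]
    norm_num
  rw [hX, hE, hQ]
  refine major_arc_error_le (by linarith) hN0 hNM hK1 hKM hl1 hC.le hsK hsq
    (Real.one_le_rpow hK1 (by norm_num)) hT2 ?_
  rw [hεdef, epsK, hNr, div_eq_mul_inv _ ((g : ℝ) ^ K)]
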